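/- Fractional Fourier inversion: if f ∈ e_{-α}L^1(T^n_α) and ∑_{m∈Z^n} |F_α(f)(m)| < ∞, then f(x) = ∑_{m∈Z^n} F_α(f)(m) K_{-α}(m,x) for almost every x ∈ T^n_α; in particular, f equals a continuous function almost everywhere. -/

import Mathlib

open MeasureTheory Filter

noncomputable section

/-- The fractional torus, realized as the cube `[-|sin α|/2, |sin α|/2]^n`. -/
def Tor (α : ℝ) (n : ℕ) : Set (Fin n → ℝ) :=
  Set.univ.pi fun _ => Set.Icc (-(|Real.sin α| / 2)) (|Real.sin α| / 2)

/-- The chirp `e_α(x) = e^{π i |x|² cot α}`. -/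
def eA (α : ℝ) {n : ℕ} (x : Fin n → ℝ) : ℂ :=
  Complex.exp (Complex.I * ((Real.pi * (∑ i, x i ^ 2) * (Real.cos α / Real.sin α) : ℝ) : ℂ))

/-- `A_α = √(1 - i cot α)`. -/
def Acoef (α : ℝ) : ℂ := (1 - Complex.I * ((Real.cos α / Real.sin α : ℝ) : ℂ)) ^ (1 / 2 : ℂ)

/-- The kernel `K_α(m,x) = A_α^n e_α(x) e^{-2π i (m·x) csc α} e_α(m)`. -/
def Kk (α : ℝ) {n : ℕ} (m : Fin n → ℤ) (x : Fin n → ℝ) : ℂ :=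
  Acoef α ^ n * eA α x *
    Complex.exp (-(Complex.I * ((2 * Real.pi * (∑ i, (m i : ℝ) * x i) / Real.sin α : ℝ) : ℂ))) *
    eA α fun i => (m i : ℝ)

/-- The `m`-th fractional Fourier coefficient of order `α`. -/
def Fcoef (α : ℝ) {n : ℕ} (f : (Fin n → ℝ) → ℂ) (m : Fin n → ℤ) : ℂ :=
  ∫ x in Tor α n, f x * Kk α m x

/-- `|sin α|`-periodicity in every coordinate. -/
def Per (α : ℝ) {n : ℕ} (f : (Fin n → ℝ) → ℂ) : Prop :=
  ∀ (x : Fin n → ℝ) (k : Fin n → ℤ), f (fun i => x i + k i * |Real.sin α|) = f x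


/-- The centered cube of side `|s|`. -/
def centeredCube (ι : Type*) (s : ℝ) : Set (ι → ℝ) :=
  Set.univ.pi fun _ => Set.Icc (-(|s| / 2)) (|s| / 2)

/-- The covering map from Euclidean space to the unit torus with period `s` in each coordinate. -/
def toTorus {ι : Type*} (s : ℝ) (x : ι → ℝ) : UnitAddTorus ι :=
  fun i => ((x i / s : ℝ) : UnitAddCircle)

section Cube

variable {ι : Type*}

lemma isCompact_centeredCube (s : ℝ) : IsCompact (centeredCube ι s) :=
  isCompact_univ_pi fun _ => isCompact_Icc

lemma continuous_toTorus (s : ℝ) : Continuous (toTorus (ι := ι) s) :=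
  continuous_pi fun i => (AddCircle.continuous_mk' 1).comp
    ((continuous_apply (A := fun _ => ℝ) i).div_const s)

lemma exists_mem_centeredCube_toTorus_eq {s : ℝ} (hs : s ≠ 0) (t : UnitAddTorus ι) :
    ∃ x ∈ centeredCube ι s, toTorus s x = t := by
  choose y hy using fun i => QuotientAddGroup.mk_surjective (t i)
  refine ⟨fun i => s * (y i - round (y i)), fun i _ => ?_, funext fun i => ?_⟩
  · rw [Set.mem_Icc, ← abs_le, abs_mul]
    have := abs_sub_round (y i)
    nlinarith [abs_nonneg s]
  · have h : s * (y i - round (y i)) / s = y i - round (y i) := by field_simp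
    simp only [toTorus, h, ← hy i]
    rw [AddCircle.coe_sub, sub_eq_self, AddCircle.coe_eq_zero_iff]
    exact ⟨round (y i), by simp⟩

lemma eq_of_toTorus_eq {s : ℝ} (hs : s ≠ 0) {x y : ι → ℝ}
    (hx : ∀ i, x i ∈ Set.Ioo (-(|s| / 2)) (|s| / 2)) (hy : y ∈ centeredCube ι s)
    (h : toTorus s x = toTorus s y) : x = y := by
  funext i
  have hi : ((x i / s : ℝ) : UnitAddCircle) = ((y i / s : ℝ) : UnitAddCircle) := congrFun h i
  rw [← sub_eq_zero, ← AddCircle.coe_sub, AddCircle.coe_eq_zero_iff] at hi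
  obtain ⟨k, hk⟩ := hi
  have hxy : x i - y i = k * s := by
    simp only [zsmul_eq_mul, mul_one] at hk
    rw [hk]; field_simp
  have h1 : |x i - y i| < |s| := by
    have hy' := hy i (Set.mem_univ i)
    have := hx i
    rw [abs_lt]
    constructor <;> linarith [this.1, this.2, hy'.1, hy'.2]
  rw [hxy, abs_mul, mul_lt_iff_lt_one_left (abs_pos.2 hs)] at h1
  have hk0 : k = 0 := Int.abs_lt_one_iff.1 (by exact_mod_cast h1)
  rw [hk0] at hxy
  simpa [sub_eq_zero] using hxy

lemma isQuotientMap_restrict_toTorus {s : ℝ} (hs : s ≠ 0) :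
    Topology.IsQuotientMap ((centeredCube ι s).domRestrict (toTorus s)) := by
  have : CompactSpace (centeredCube ι s) := isCompact_iff_compactSpace.1 (isCompact_centeredCube s)
  have hc : Continuous ((centeredCube ι s).domRestrict (toTorus s)) :=
    (continuous_toTorus s).comp continuous_subtype_val
  refine hc.isClosedMap.isQuotientMap hc fun t => ?_
  obtain ⟨x, hx, hxt⟩ := exists_mem_centeredCube_toTorus_eq hs t
  exact ⟨⟨x, hx⟩, hxt⟩

/-- A continuous function supported in the open cube descends to the torus. -/
lemma exists_continuousMap_torus_eqOn {s : ℝ} (hs : s ≠ 0) {g : (ι → ℝ) → ℂ} (hg : Continuous g)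
    (hsupp : Function.support g ⊆ {x | ∀ i, x i ∈ Set.Ioo (-(|s| / 2)) (|s| / 2)}) :
    ∃ φ : C(UnitAddTorus ι, ℂ), ∀ x ∈ centeredCube ι s, φ (toTorus s x) = g x := by
  let p : C(centeredCube ι s, UnitAddTorus ι) :=
    ⟨(centeredCube ι s).domRestrict (toTorus s), (isQuotientMap_restrict_toTorus hs).continuous⟩
  have hp : Topology.IsQuotientMap p := isQuotientMap_restrict_toTorus hs
  let g' : C(centeredCube ι s, ℂ) := ⟨fun x => g x, hg.comp continuous_subtype_val⟩
  have hfac : Function.FactorsThrough g' p := by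
    intro x y hxy
    change g x = g y
    by_cases hx : g x = 0
    · by_cases hy : g y = 0
      · rw [hx, hy]
      · rw [eq_of_toTorus_eq hs (hsupp hy) x.2 hxy.symm]
    · rw [eq_of_toTorus_eq hs (hsupp hx) y.2 hxy]
  refine ⟨hp.lift g' hfac, fun x hx => ?_⟩
  exact congrArg (fun F : C(centeredCube ι s, ℂ) => F ⟨x, hx⟩) (hp.lift_comp g' hfac)

variable [Fintype ι]

lemma integrableOn_mul_comp_toTorus {s : ℝ} {h : (ι → ℝ) → ℂ}
    (hh : IntegrableOn h (centeredCube ι s)) (φ : C(UnitAddTorus ι, ℂ)) :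
    IntegrableOn (fun x => h x * φ (toTorus s x)) (centeredCube ι s) :=
  hh.mul_bdd (c := ‖φ‖) (φ.continuous.comp (continuous_toTorus s)).aestronglyMeasurable
    (ae_of_all _ fun _ => φ.norm_coe_le_norm _)

/-- A function on the cube with vanishing Fourier coefficients is orthogonal to all continuous
functions on the torus. -/
lemma integral_mul_comp_toTorus_eq_zero {s : ℝ} {h : (ι → ℝ) → ℂ}
    (hh : IntegrableOn h (centeredCube ι s))
    (h0 : ∀ m : ι → ℤ, ∫ x in centeredCube ι s, h x * UnitAddTorus.mFourier m (toTorus s x) = 0)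
    (φ : C(UnitAddTorus ι, ℂ)) :
    ∫ x in centeredCube ι s, h x * φ (toTorus s x) = 0 := by
  let L : C(UnitAddTorus ι, ℂ) →ₗ[ℂ] ℂ :=
    { toFun := fun φ => ∫ x in centeredCube ι s, h x * φ (toTorus s x)
      map_add' := fun φ ψ => by
        simp only [ContinuousMap.add_apply, mul_add]
        exact integral_add (integrableOn_mul_comp_toTorus hh φ) (integrableOn_mul_comp_toTorus hh ψ)
      map_smul' := fun c φ => by
        simp only [ContinuousMap.smul_apply, smul_eq_mul, mul_left_comm _ c, RingHom.id_apply]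
        exact integral_const_mul _ _ }
  have hL : ∀ φ, ‖L φ‖ ≤ (∫ x in centeredCube ι s, ‖h x‖) * ‖φ‖ := fun φ => by
    rw [← integral_mul_const]
    refine norm_integral_le_of_norm_le (hh.norm.mul_const _) (ae_of_all _ fun x => ?_)
    rw [norm_mul]
    gcongr
    exact φ.norm_coe_le_norm _
  let L' := L.mkContinuous _ hL
  have hker : (⊤ : Submodule ℂ C(UnitAddTorus ι, ℂ)) ≤ LinearMap.ker L'.toLinearMap := by
    rw [← UnitAddTorus.span_mFourier_closure_eq_top]
    refine Submodule.topologicalClosure_minimal _ (Submodule.span_le.2 ?_) L'.isClosed_ker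
    rintro _ ⟨m, rfl⟩
    exact h0 m
  exact hker (Submodule.mem_top (x := φ))

/-- Uniqueness of Fourier coefficients for integrable functions on the cube. -/
lemma ae_eq_zero_of_fourier_eq_zero {s : ℝ} (hs : s ≠ 0) {h : (ι → ℝ) → ℂ}
    (hh : IntegrableOn h (centeredCube ι s))
    (h0 : ∀ m : ι → ℤ, ∫ x in centeredCube ι s, h x * UnitAddTorus.mFourier m (toTorus s x) = 0) :
    ∀ᵐ x ∂(volume.restrict (centeredCube ι s)), h x = 0 := by
  let U : Set (ι → ℝ) := Set.univ.pi fun _ => Set.Ioo (-(|s| / 2)) (|s| / 2)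
  have hU : IsOpen U := isOpen_set_pi Set.finite_univ fun _ _ => isOpen_Ioo
  have hUC : U ⊆ centeredCube ι s := Set.pi_mono fun _ _ => Set.Ioo_subset_Icc_self
  have hae : U =ᵐ[volume] centeredCube ι s := Measure.univ_pi_Ioo_ae_eq_Icc.trans
    (by rw [← Set.pi_univ_Icc]; rfl)
  rw [← Measure.restrict_congr_set hae, ae_restrict_iff' hU.measurableSet]
  refine hU.ae_eq_zero_of_integral_contDiff_smul_eq_zero (hh.mono_set hUC).locallyIntegrableOn
    fun g hg _ hsupp => ?_
  obtain ⟨φ, hφ⟩ := exists_continuousMap_torus_eqOn (g := fun x => (g x : ℂ)) hs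
    (Complex.continuous_ofReal.comp hg.continuous) (fun x hx i => hsupp (subset_tsupport g
      (fun h => hx (by simp [h]))) i (Set.mem_univ i))
  rw [← integral_mul_comp_toTorus_eq_zero hh h0 φ, ← setIntegral_eq_integral_of_forall_compl_eq_zero
    (s := centeredCube ι s)]
  · refine setIntegral_congr_fun (isCompact_centeredCube s).measurableSet fun x hx => ?_
    simp only [hφ x hx, Complex.real_smul, mul_comm]
  · intro x hx
    have : g x = 0 := by
      by_contra hne
      exact hx (hUC (hsupp (subset_tsupport g hne)))
    simp [this]

lemma integral_fourier_div {s : ℝ} (hs : s ≠ 0) (k : ℤ) :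
    ∫ x in Set.Icc (-(|s| / 2)) (|s| / 2), fourier k ((x / s : ℝ) : UnitAddCircle) =
      if k = 0 then ((|s| : ℝ) : ℂ) else 0 := by
  rw [integral_Icc_eq_integral_Ioc, ← intervalIntegral.integral_of_le
    (by linarith [abs_nonneg s])]
  split_ifs with hk
  · simp [hk]
  · have hsC : (s : ℂ) ≠ 0 := by exact_mod_cast hs
    have hc : 2 * Real.pi * Complex.I * k / s ≠ 0 := by
      simp [hk, hs, Real.pi_ne_zero]
    have : ∀ x : ℝ, fourier k ((x / s : ℝ) : UnitAddCircle) =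
        Complex.exp (2 * Real.pi * Complex.I * k / s * x) := fun x => by
      rw [fourier_coe_apply]
      congr 1
      push_cast
      field_simp
    simp_rw [this]
    rw [integral_exp_mul_complex hc, div_eq_zero_iff, sub_eq_zero, Complex.exp_eq_exp_iff_exists_int]
    left
    rcases abs_choice s with h | h
    · refine ⟨k, ?_⟩
      rw [h]; push_cast; field_simp; ring
    · refine ⟨-k, ?_⟩
      rw [h]; push_cast; field_simp; ring

lemma integral_mFourier_toTorus {s : ℝ} (hs : s ≠ 0) (m : ι → ℤ) :
    ∫ x in centeredCube ι s, UnitAddTorus.mFourier m (toTorus s x) =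
      if m = 0 then ((|s| : ℝ) : ℂ) ^ Fintype.card ι else 0 := by
  have : (volume : Measure (ι → ℝ)).restrict (centeredCube ι s) =
      Measure.pi fun _ => volume.restrict (Set.Icc (-(|s| / 2)) (|s| / 2)) := by
    rw [volume_pi, centeredCube, Measure.restrict_pi_pi]
  rw [this]
  simp only [UnitAddTorus.mFourier, ContinuousMap.coe_mk, toTorus]
  rw [integral_fintype_prod_eq_prod (f := fun i (x : ℝ) =>
    fourier (m i) ((x / s : ℝ) : UnitAddCircle))]
  simp_rw [integral_fourier_div hs]
  split_ifs with h
  · simp [h]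
  · obtain ⟨i, hi⟩ := Function.ne_iff.1 h
    exact Finset.prod_eq_zero (Finset.mem_univ i) (if_neg hi)

lemma norm_mFourier_apply (m : ι → ℤ) (t : UnitAddTorus ι) :
    ‖UnitAddTorus.mFourier m t‖ = 1 := by
  simp only [UnitAddTorus.mFourier, ContinuousMap.coe_mk, norm_prod, fourier_apply,
    Circle.norm_coe, Finset.prod_const_one]

/-- A function on the cube with absolutely summable Fourier coefficients is the sum of its Fourier
series almost everywhere. -/
lemma ae_eq_tsum_fourier {s : ℝ} (hs : s ≠ 0) {u : (ι → ℝ) → ℂ}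
    (hu : IntegrableOn u (centeredCube ι s)) (c : (ι → ℤ) → ℂ)
    (hc : ∀ m, c m = ∫ x in centeredCube ι s, u x * UnitAddTorus.mFourier (-m) (toTorus s x))
    (hsum : Summable fun m => ‖c m‖) :
    ∀ᵐ x ∂(volume.restrict (centeredCube ι s)),
      u x = (((|s| : ℝ) : ℂ) ^ Fintype.card ι)⁻¹ * ∑' m, c m * UnitAddTorus.mFourier m (toTorus s x) := by
  set V : ℂ := ((|s| : ℝ) : ℂ) ^ Fintype.card ι with hV
  have hV0 : V ≠ 0 := pow_ne_zero _ (by simpa using hs)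
  let w : (ι → ℝ) → ℂ := fun x => ∑' m, c m * UnitAddTorus.mFourier m (toTorus s x)
  have hmcont : ∀ m : ι → ℤ, Continuous fun x => UnitAddTorus.mFourier m (toTorus s x) :=
    fun m => (UnitAddTorus.mFourier m).continuous.comp (continuous_toTorus s)
  have hw : Continuous w := continuous_tsum (fun m => continuous_const.mul (hmcont m)) hsum
    fun m x => by rw [norm_mul, norm_mFourier_apply, mul_one]
  have hwi : IntegrableOn w (centeredCube ι s) :=
    hw.continuousOn.integrableOn_compact (isCompact_centeredCube s)
  have hwc : ∀ k : ι → ℤ, ∫ x in centeredCube ι s,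
      w x * UnitAddTorus.mFourier k (toTorus s x) = V * c (-k) := fun k => by
    have h1 : ∀ m : ι → ℤ, ∫ x in centeredCube ι s, c m * UnitAddTorus.mFourier (m + k)
        (toTorus s x) = if m = -k then V * c (-k) else 0 := fun m => by
      rw [integral_const_mul, integral_mFourier_toTorus hs]
      by_cases h : m = -k
      · simp [h, hV, mul_comm]
      · rw [if_neg h, if_neg (by rwa [← eq_neg_iff_add_eq_zero]), mul_zero]
    have h2 := hasSum_integral_of_summable_integral_norm
      (μ := volume.restrict (centeredCube ι s))
      (F := fun (m : ι → ℤ) x => c m * UnitAddTorus.mFourier (m + k) (toTorus s x))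
      (fun m => ((continuous_const.mul (hmcont _)).continuousOn.integrableOn_compact
        (isCompact_centeredCube s)))
      (by simpa [norm_mFourier_apply] using hsum.mul_left _)
    simp_rw [h1] at h2
    rw [(hasSum_ite_eq (-k) (V * c (-k))).unique h2]
    simp only [w, ← tsum_mul_right, UnitAddTorus.mFourier_add, mul_assoc]
  have key := ae_eq_zero_of_fourier_eq_zero hs (h := fun x => u x - V⁻¹ * w x)
    (hu.sub (hwi.const_mul _)) fun k => by
      simp only [sub_mul, mul_assoc]
      rw [integral_sub (integrableOn_mul_comp_toTorus hu _)
        ((integrableOn_mul_comp_toTorus hwi _).const_mul _), integral_const_mul, hwc, hc (-k),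
        neg_neg, inv_mul_cancel_left₀ hV0, sub_self]
  filter_upwards [key] with x hx using sub_eq_zero.1 hx

end Cube

section Kernel

variable {α : ℝ} {n : ℕ}

lemma continuous_eA : Continuous (eA α (n := n)) := by
  unfold eA
  fun_prop

lemma norm_eA (x : Fin n → ℝ) : ‖eA α x‖ = 1 := by
  rw [eA, mul_comm, Complex.norm_exp_ofReal_mul_I]

lemma eA_mul_eA_neg (x : Fin n → ℝ) : eA α x * eA (-α) x = 1 := by
  rw [eA, eA, ← Complex.exp_add, Real.cos_neg, Real.sin_neg, div_neg, mul_neg, Complex.ofReal_neg,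
    mul_neg, add_neg_cancel, Complex.exp_zero]

lemma Acoef_mul_Acoef_neg (hs : Real.sin α ≠ 0) :
    Acoef α * Acoef (-α) = ((|Real.sin α| : ℝ) : ℂ)⁻¹ := by
  set z : ℂ := 1 - Complex.I * ((Real.cos α / Real.sin α : ℝ) : ℂ) with hz
  have harg : z.arg ≠ Real.pi := fun h => by
    have := (Complex.arg_eq_pi_iff.1 h).1
    simp only [hz, Complex.sub_re, Complex.one_re, Complex.re_mul_ofReal, Complex.I_re] at this
    norm_num at this
  have hneg : Acoef (-α) = (starRingEnd ℂ) (Acoef α) := by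
    have h1 : Acoef (-α) = (starRingEnd ℂ) z ^ (1 / 2 : ℂ) := by
      rw [Acoef, hz, map_sub, map_one, map_mul, Complex.conj_I, Complex.conj_ofReal, Real.cos_neg,
        Real.sin_neg, div_neg, Complex.ofReal_neg, mul_neg, neg_mul]
    have h2 : (starRingEnd ℂ) (1 / 2 : ℂ) = 1 / 2 := by
      rw [map_div₀, map_one, map_ofNat]
    rw [h1, Complex.conj_cpow _ _ harg, h2, Acoef]
  have hsq : Acoef α ^ 2 = z := by
    simp [Acoef, hz]
  have hnorm : ‖z‖ = |Real.sin α|⁻¹ := by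
    rw [← sq_eq_sq₀ (norm_nonneg _) (by positivity), ← Complex.normSq_eq_norm_sq, inv_pow, sq_abs,
      hz, Complex.normSq_apply]
    simp only [Complex.sub_re, Complex.sub_im, Complex.one_re, Complex.one_im,
      Complex.re_mul_ofReal, Complex.im_mul_ofReal, Complex.I_re, Complex.I_im]
    field_simp
    nlinarith [Real.sin_sq_add_cos_sq α]
  rw [hneg, Complex.mul_conj, Complex.normSq_eq_norm_sq, ← norm_pow, hsq, hnorm, Complex.ofReal_inv]

lemma Acoef_ne_zero (hs : Real.sin α ≠ 0) : Acoef α ≠ 0 := fun h => by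
  have := Acoef_mul_Acoef_neg hs
  rw [h, zero_mul, eq_comm, inv_eq_zero] at this
  simp [hs] at this

lemma mFourier_toTorus (s : ℝ) (m : Fin n → ℤ) (x : Fin n → ℝ) :
    UnitAddTorus.mFourier m (toTorus s x) =
      Complex.exp (Complex.I * ((2 * Real.pi * (∑ i, (m i : ℝ) * x i) / s : ℝ) : ℂ)) := by
  simp only [UnitAddTorus.mFourier, ContinuousMap.coe_mk, toTorus, fourier_coe_apply]
  rw [← Complex.exp_sum]
  congr 1
  push_cast
  rw [Finset.mul_sum, Finset.sum_div, Finset.mul_sum]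
  exact Finset.sum_congr rfl fun i _ => by ring

lemma Kk_eq (m : Fin n → ℤ) (x : Fin n → ℝ) :
    Kk α m x = Acoef α ^ n * eA α x *
      UnitAddTorus.mFourier (-m) (toTorus (Real.sin α) x) * eA α fun i => (m i : ℝ) := by
  rw [Kk, mFourier_toTorus]
  congr 3
  simp only [Pi.neg_apply, Int.cast_neg, neg_mul, Finset.sum_neg_distrib, mul_neg, neg_div,
    Complex.ofReal_neg]

lemma Kk_neg_eq (m : Fin n → ℤ) (x : Fin n → ℝ) :
    Kk (-α) m x = Acoef (-α) ^ n * eA (-α) x *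
      UnitAddTorus.mFourier m (toTorus (Real.sin α) x) * eA (-α) fun i => (m i : ℝ) := by
  rw [Kk, mFourier_toTorus, Real.sin_neg]
  congr 3
  simp only [div_neg, Complex.ofReal_neg, mul_neg, neg_neg]

lemma Fcoef_eq (f : (Fin n → ℝ) → ℂ) (m : Fin n → ℤ) :
    Fcoef α f m = Acoef α ^ n * (eA α fun i => (m i : ℝ)) *
      ∫ x in centeredCube (Fin n) (Real.sin α),
        eA α x * f x * UnitAddTorus.mFourier (-m) (toTorus (Real.sin α) x) := by
  rw [Fcoef, ← integral_const_mul]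
  refine integral_congr_ae (ae_of_all _ fun x => ?_)
  simp only [Kk_eq]
  ring

end Kernel

theorem stmt14 (α : ℝ) (hα : ∀ k : ℤ, α ≠ k * Real.pi) (n : ℕ)
    (f : (Fin n → ℝ) → ℂ)
    (hper : Per α fun x => eA α x * f x)
    (hf : IntegrableOn (fun x => eA α x * f x) (Tor α n))
    (hsum : Summable fun m : Fin n → ℤ => ‖Fcoef α f m‖) :
    (∀ᵐ x ∂(volume.restrict (Tor α n)),
        f x = ∑' m : Fin n → ℤ, Fcoef α f m * Kk (-α) m x) ∧
      ∃ g : (Fin n → ℝ) → ℂ, Continuous g ∧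
        ∀ᵐ x ∂(volume.restrict (Tor α n)), f x = g x := by
  have hs : Real.sin α ≠ 0 := fun h => by
    obtain ⟨k, hk⟩ := Real.sin_eq_zero_iff.1 h
    exact hα k hk.symm
  set s := Real.sin α with hsdef
  let c : (Fin n → ℤ) → ℂ := fun m => ∫ x in centeredCube (Fin n) s,
    eA α x * f x * UnitAddTorus.mFourier (-m) (toTorus s x)
  have hF : ∀ m, Fcoef α f m = Acoef α ^ n * (eA α fun i => (m i : ℝ)) * c m := Fcoef_eq f
  have hA : ‖Acoef α ^ n‖ ≠ 0 := norm_ne_zero_iff.2 (pow_ne_zero _ (Acoef_ne_zero hs))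
  have hc : Summable fun m => ‖c m‖ := by
    simp_rw [hF, norm_mul, norm_eA, mul_one] at hsum
    exact (summable_mul_left_iff hA).1 hsum
  have hterm : ∀ m x, Fcoef α f m * Kk (-α) m x =
      eA (-α) x * (((|s| : ℝ) : ℂ) ^ n)⁻¹ * (c m * UnitAddTorus.mFourier m (toTorus s x)) := by
    intro m x
    rw [← inv_pow, ← Acoef_mul_Acoef_neg hs, mul_pow, hF, Kk_neg_eq]
    linear_combination (Acoef α ^ n * Acoef (-α) ^ n * eA (-α) x * c m *
      UnitAddTorus.mFourier m (toTorus s x)) * eA_mul_eA_neg (α := α) fun i => (m i : ℝ)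
  have hseries : ∀ x, ∑' m : Fin n → ℤ, Fcoef α f m * Kk (-α) m x =
      eA (-α) x * (((|s| : ℝ) : ℂ) ^ n)⁻¹ *
        ∑' m, c m * UnitAddTorus.mFourier m (toTorus s x) := fun x => by
    simp_rw [hterm, tsum_mul_left]
  have hae : ∀ᵐ x ∂(volume.restrict (Tor α n)),
      f x = ∑' m : Fin n → ℤ, Fcoef α f m * Kk (-α) m x := by
    filter_upwards [ae_eq_tsum_fourier hs hf c (fun _ => rfl) hc] with x hx
    rw [Fintype.card_fin] at hx
    rw [hseries, mul_assoc, ← hx, ← mul_assoc, mul_comm (eA (-α) x), eA_mul_eA_neg, one_mul]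
  refine ⟨hae, _, ?_, hae⟩
  simp_rw [hseries]
  refine (continuous_eA.mul continuous_const).mul (continuous_tsum (fun m => continuous_const.mul
    ((UnitAddTorus.mFourier m).continuous.comp (continuous_toTorus s))) hc fun m x => ?_)
  rw [norm_mul, norm_mFourier_apply, mul_one]
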